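/- Let 𝔤 = ⟨∂_x, ∂_y, y∂_x⟩ be the Heisenberg algebra on ℂ² and 𝔤^(1) = ⟨∂_x, ∂_y, y∂_x − y₁²∂_{y₁}⟩ its prolongation to the chart with coordinates (x, y, y₁). Then every holomorphic 1-cocycle λ : 𝔤^(1) → O(ℂ³) is cohomologous to one with λ(∂_x) = λ(∂_y) = 0 and λ(y∂_x − y₁²∂_{y₁}) = A + B·y₁ for constants A, B ∈ ℂ; in particular H¹(𝔤^(1), O(ℂ³)) ≅ ℂ². -/

import Mathlib

open Complex Metric Topology

section EntireFunctions

variable {E : Type*} [NormedAddCommGroup E] [NormedSpace ℂ E] {f : E → ℂ}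

/-- Differentiation under the integral sign over a compact interval, when the derivative in the
parameter is jointly continuous. -/
theorem hasFDerivAt_intervalIntegral_of_continuous [ProperSpace E] {F : E → ℝ → ℂ}
    {F' : E → ℝ → E →L[ℂ] ℂ} (hF : ∀ v, Continuous (F v)) (hF' : Continuous F'.uncurry)
    (hd : ∀ v t, HasFDerivAt (F · t) (F' v t) v) (α β : ℝ) (v : E) :
    HasFDerivAt (fun w => ∫ t in α..β, F w t) (∫ t in α..β, F' v t) v := by
  obtain ⟨C, hC⟩ := ((isCompact_closedBall v 1).prod
    (isCompact_uIcc (a := α) (b := β))).exists_bound_of_continuousOn hF'.continuousOn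
  have hv : Continuous (F' v) := hF'.comp (Continuous.prodMk_right v)
  refine intervalIntegral.hasFDerivAt_integral_of_dominated_of_fderiv_le
    (bound := fun _ => C) (closedBall_mem_nhds v one_pos) (.of_forall fun w => ?_)
    ((hF v).intervalIntegrable _ _) ?_ ?_ intervalIntegrable_const (.of_forall fun t _ w _ => hd w t)
  · exact (hF w).aestronglyMeasurable
  · exact hv.aestronglyMeasurable
  · exact .of_forall fun t ht w hw => hC (w, t) ⟨hw, Set.uIoc_subset_uIcc ht⟩

/-- The restriction of `f` to a complex line has the directional derivative as its derivative. -/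
theorem Differentiable.hasDerivAt_line (hf : Differentiable ℂ f) (v e : E) (z : ℂ) :
    HasDerivAt (fun z : ℂ => f (v + z • e)) (fderiv ℂ f (v + z • e) e) z := by
  have h : HasDerivAt (fun z : ℂ => v + z • e) e z := by
    simpa using ((hasDerivAt_id z).smul_const e).const_add v
  exact (hf _).hasFDerivAt.comp_hasDerivAt z h

/-- Cauchy's integral formula for directional derivatives, with a kernel independent of `f`. -/
theorem exists_kernel_fderiv_apply_eq_integral : ∃ k : ℝ → ℂ, Continuous k ∧
    ∀ f : E → ℂ, Differentiable ℂ f → ∀ v e,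
      fderiv ℂ f v e = ∫ θ in (0 : ℝ)..2 * Real.pi, k θ * f (v + circleMap 0 1 θ • e) := by
  have h0 : ∀ θ, circleMap 0 1 θ ≠ 0 := fun θ => circleMap_ne_center one_ne_zero
  refine ⟨fun θ => (2 * Real.pi * I : ℂ)⁻¹ * (circleMap 0 1 θ * I * (circleMap 0 1 θ ^ 2)⁻¹),
    ?_, fun f hf v e => ?_⟩
  · have hc := continuous_circleMap 0 1
    exact continuous_const.mul
      ((hc.mul continuous_const).mul ((hc.pow 2).inv₀ fun θ => pow_ne_zero 2 (h0 θ)))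
  · have hline := hf.hasDerivAt_line v e
    have h := two_pi_I_inv_smul_circleIntegral_sub_sq_inv_smul_of_differentiable isOpen_univ
      (Set.subset_univ (closedBall (0 : ℂ) 1))
      (fun z _ => (hline z).differentiableAt.differentiableWithinAt) (mem_ball_self one_pos)
    rw [(hline 0).deriv, zero_smul, add_zero] at h
    rw [← h, circleIntegral, ← intervalIntegral.integral_smul]
    refine intervalIntegral.integral_congr fun θ _ => ?_
    simp only [deriv_circleMap, smul_eq_mul, sub_zero]
    ring

/-- A function with vanishing derivative in the direction `e` is constant along `e`. -/
theorem Differentiable.apply_add_smul_eq (hf : Differentiable ℂ f) {e : E}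
    (h : ∀ v, fderiv ℂ f v e = 0) (v : E) (z : ℂ) : f (v + z • e) = f v := by
  have hline := hf.hasDerivAt_line v e
  have := is_const_of_deriv_eq_zero (fun z => (hline z).differentiableAt)
    (fun z => (hline z).deriv.trans (h _)) z 0
  simpa using this

variable [FiniteDimensional ℂ E]

theorem Differentiable.continuous_fderiv_of_complex (hf : Differentiable ℂ f) :
    Continuous (fderiv ℂ f) := by
  obtain ⟨k, hk, h⟩ := exists_kernel_fderiv_apply_eq_integral (E := E)
  refine continuous_clm_apply.2 fun e => ?_
  simp_rw [h f hf]
  refine intervalIntegral.continuous_parametric_intervalIntegral_of_continuous' ?_ _ _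
  have := hf.continuous
  have := continuous_circleMap 0 1
  simp only [Function.uncurry_def]
  fun_prop

theorem Differentiable.contDiff_one_of_complex (hf : Differentiable ℂ f) : ContDiff ℂ 1 f :=
  contDiff_one_iff_fderiv.2 ⟨hf, hf.continuous_fderiv_of_complex⟩

/-- Directional derivatives of a holomorphic function are holomorphic. -/
theorem Differentiable.fderiv_apply_of_complex (hf : Differentiable ℂ f) (e : E) :
    Differentiable ℂ fun v => fderiv ℂ f v e := by
  have : ProperSpace E := FiniteDimensional.proper ℂ E
  obtain ⟨k, hk, h⟩ := exists_kernel_fderiv_apply_eq_integral (E := E)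
  simp_rw [h f hf]
  have hc := hf.continuous
  have hc' := hf.continuous_fderiv_of_complex
  have hm := continuous_circleMap 0 1
  intro v
  refine (hasFDerivAt_intervalIntegral_of_continuous
    (F' := fun v θ => k θ • fderiv ℂ f (v + circleMap 0 1 θ • e)) (fun v => by fun_prop)
    (by simp only [Function.uncurry_def]; fun_prop) (fun v θ => ?_) _ _ v).differentiableAt
  exact ((hf _).hasFDerivAt.comp v ((hasFDerivAt_id v).add_const (circleMap 0 1 θ • e))).const_mul
    (k θ)

/-- Directional derivatives of a holomorphic function commute. -/
theorem Differentiable.fderiv_fderiv_apply_comm (hf : Differentiable ℂ f) (v e e' : E) :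
    fderiv ℂ (fun w => fderiv ℂ f w e) v e' = fderiv ℂ (fun w => fderiv ℂ f w e') v e := by
  have hd : Differentiable ℂ (fderiv ℂ f) := (contDiff_clm_apply_iff.2 fun e =>
    (hf.fderiv_apply_of_complex e).contDiff_one_of_complex).differentiable one_ne_zero
  have key : ∀ e e', fderiv ℂ (fun w => fderiv ℂ f w e) v e' = fderiv ℂ (fderiv ℂ f) v e' e := by
    intro e e'
    rw [fderiv_clm_apply (hd v) (differentiableAt_const e)]
    simp
  rw [key, key]
  exact second_derivative_symmetric (fun y => (hf y).hasFDerivAt) (hd v).hasFDerivAt e' e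

/-- Every holomorphic function has a holomorphic primitive in a given nonzero direction. -/
theorem Differentiable.exists_directional_primitive (hf : Differentiable ℂ f) {e : E}
    {ℓ : E →L[ℂ] ℂ} (hℓ : ℓ e = 1) :
    ∃ g : E → ℂ, Differentiable ℂ g ∧ ∀ v, fderiv ℂ g v e = f v := by
  have : ProperSpace E := FiniteDimensional.proper ℂ E
  have hc := hf.continuous
  have hc' := hf.continuous_fderiv_of_complex
  -- `L t` fixes `ker ℓ` and scales `e` by `t`.
  let L : ℝ → E →L[ℂ] E := fun t => .id ℂ E + ((t : ℂ) - 1) • ℓ.smulRight e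
  have hLc : Continuous L := by fun_prop
  have hLe : ∀ t, L t e = (t : ℂ) • e := fun t => by simp [L, hℓ, sub_smul]
  have hL : ∀ v, ∃ w, ∀ t : ℝ, L t v = w + (t : ℂ) • ℓ v • e := fun v =>
    ⟨v - ℓ v • e, fun t => by simp [L, sub_smul]; abel⟩
  have hK : ∀ v, HasFDerivAt (fun w => ∫ t in (0 : ℝ)..1, f (L t w))
      (∫ t in (0 : ℝ)..1, (fderiv ℂ f (L t v)).comp (L t)) v := by
    refine hasFDerivAt_intervalIntegral_of_continuous
      (F' := fun v t => (fderiv ℂ f (L t v)).comp (L t)) (fun v => by fun_prop)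
      (by simp only [Function.uncurry_def]; fun_prop) (fun v t => ?_) 0 1
    exact (hf _).hasFDerivAt.comp v (L t).hasFDerivAt
  refine ⟨fun v => ℓ v * ∫ t in (0 : ℝ)..1, f (L t v),
    ℓ.differentiable.mul fun v => (hK v).differentiableAt, fun v => ?_⟩
  have hI : Continuous fun t : ℝ => (fderiv ℂ f (L t v)).comp (L t) := by fun_prop
  have hder : ∀ t : ℝ, HasDerivAt (fun s : ℝ => (s : ℂ) * f (L s v))
      (f (L t v) + ℓ v * (fderiv ℂ f (L t v)).comp (L t) e) t := by
    intro t
    have h : HasDerivAt (fun s : ℝ => f (L s v)) (fderiv ℂ f (L t v) (ℓ v • e)) t := by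
      obtain ⟨w, hw⟩ := hL v
      simp only [hw]
      exact (hf.hasDerivAt_line w (ℓ v • e) t).comp_ofReal
    refine ((hasDerivAt_id (t : ℂ)).comp_ofReal.mul h).congr_deriv ?_
    simp [hLe]
    ring
  have hFTC := intervalIntegral.integral_eq_sub_of_hasDerivAt (a := 0) (b := 1)
    (fun t _ => hder t) (Continuous.intervalIntegrable (by fun_prop) _ _)
  rw [intervalIntegral.integral_add (Continuous.intervalIntegrable (by fun_prop) _ _)
    (Continuous.intervalIntegrable (by fun_prop) _ _), intervalIntegral.integral_const_mul,
    ← ContinuousLinearMap.intervalIntegral_apply (hI.intervalIntegrable _ _)] at hFTC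
  have h1 : L 1 v = v := by simp [L]
  have hg : HasFDerivAt (fun v => ℓ v * ∫ t in (0 : ℝ)..1, f (L t v)) _ v :=
    ℓ.hasFDerivAt.mul (hK v)
  rw [hg.fderiv]
  simp [h1] at hFTC
  simp [hℓ]
  linear_combination hFTC

/-- Second-order Taylor expansion of an entire function, the remainder being `z ^ 2` times the
derivative of an entire function. -/
theorem exists_eq_add_sq_mul_deriv_of_entire {f : ℂ → ℂ} (hf : Differentiable ℂ f) :
    ∃ (A B : ℂ) (g : ℂ → ℂ), Differentiable ℂ g ∧ ∀ z, f z = A + B * z + z ^ 2 * deriv g z := by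
  have hds : ∀ {f : ℂ → ℂ}, Differentiable ℂ f → Differentiable ℂ (dslope f 0) := fun hf =>
    differentiableOn_univ.1 ((differentiableOn_dslope Filter.univ_mem).2 hf.differentiableOn)
  obtain ⟨g, hg, hg'⟩ := (hds (hds hf)).exists_directional_primitive
    (e := 1) (ℓ := .id ℂ ℂ) rfl
  refine ⟨f 0, dslope f 0 0, g, hg, fun z => ?_⟩
  have h1 := sub_smul_dslope f 0 z
  have h2 := sub_smul_dslope (dslope f 0) 0 z
  rw [← fderiv_apply_one_eq_deriv, hg']
  simp only [smul_eq_mul, sub_zero] at h1 h2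
  linear_combination -h1 - z * h2

/-- A pair of holomorphic functions satisfying the closedness condition in two independent
directions has a common holomorphic potential. -/
theorem exists_potential_of_closed {a b : E → ℂ} (ha : Differentiable ℂ a)
    (hb : Differentiable ℂ b) {e₁ e₂ : E} {ℓ₁ ℓ₂ : E →L[ℂ] ℂ} (h₁₁ : ℓ₁ e₁ = 1) (h₁₂ : ℓ₁ e₂ = 0)
    (h₂₂ : ℓ₂ e₂ = 1) (hab : ∀ v, fderiv ℂ b v e₁ = fderiv ℂ a v e₂) :
    ∃ m : E → ℂ, Differentiable ℂ m ∧ (∀ v, fderiv ℂ m v e₁ = a v) ∧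
      ∀ v, fderiv ℂ m v e₂ = b v := by
  obtain ⟨g, hg, hga⟩ := ha.exists_directional_primitive h₁₁
  have hg₂ := hg.fderiv_apply_of_complex e₂
  have hr : Differentiable ℂ fun v => b v - fderiv ℂ g v e₂ := hb.sub hg₂
  obtain ⟨k, hk, hkr⟩ := hr.exists_directional_primitive h₂₂
  have hr₁ : ∀ v, fderiv ℂ (fun v => b v - fderiv ℂ g v e₂) v e₁ = 0 := fun v => by
    rw [fderiv_fun_sub (hb v) (hg₂ v), sub_apply, hg.fderiv_fderiv_apply_comm]
    simp [hga, hab]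
  -- the projection onto `ker ℓ₁` along `e₁`
  let P : E →L[ℂ] E := .id ℂ E - ℓ₁.smulRight e₁
  have hP : ∀ v, P v = v + (-ℓ₁ v) • e₁ := fun v => by simp [P, sub_eq_add_neg]
  have hm : ∀ v, HasFDerivAt (fun v => g v + k (P v)) (fderiv ℂ g v + (fderiv ℂ k (P v)).comp P) v :=
    fun v => (hg v).hasFDerivAt.add ((hk _).hasFDerivAt.comp v P.hasFDerivAt)
  refine ⟨fun v => g v + k (P v), fun v => (hm v).differentiableAt, fun v => ?_, fun v => ?_⟩
  · rw [(hm v).fderiv]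
    simp [hP e₁, h₁₁, hga]
  · have hPr : b (P v) - fderiv ℂ g (P v) e₂ = b v - fderiv ℂ g v e₂ := by
      rw [hP]; exact hr.apply_add_smul_eq hr₁ v _
    rw [(hm v).fderiv]
    simp [hP e₂, h₁₂, hkr, hPr]

end EntireFunctions

theorem ContinuousLinearMap.apply_cons_zero (T : (Fin 3 → ℂ) →L[ℂ] ℂ) (p q : ℂ) :
    T ![p, 0, q] = p * T ![1, 0, 0] + q * T ![0, 0, 1] := by
  have : (![p, 0, q] : Fin 3 → ℂ) = p • ![1, 0, 0] + q • ![0, 0, 1] := by simp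
  rw [this, map_add, map_smul, map_smul, smul_eq_mul, smul_eq_mul]

/-- For the prolonged Heisenberg algebra
`𝔤⁽¹⁾ = ⟨∂_x, ∂_y, y∂_x − y₁²∂_{y₁}⟩` on `ℂ³` with coordinates
`(x, y, y₁) = (v 0, v 1, v 2)`, every holomorphic 1-cocycle `(a, b, c)`
(with cocycle conditions for `[∂_x,∂_y]=0`, `[∂_x, e₃]=0`, `[∂_y, e₃]=∂_x`)
is cohomologous to one with `λ(∂_x)=λ(∂_y)=0` and
`λ(e₃) = A + B·y₁`, for constants `A, B ∈ ℂ`. -/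
theorem stmt_16 (a b c : (Fin 3 → ℂ) → ℂ)
    (ha : Differentiable ℂ a) (hb : Differentiable ℂ b) (hc : Differentiable ℂ c)
    (h12 : ∀ v : Fin 3 → ℂ,
      fderiv ℂ b v ![1, 0, 0] - fderiv ℂ a v ![0, 1, 0] = 0)
    (h13 : ∀ v : Fin 3 → ℂ,
      fderiv ℂ c v ![1, 0, 0] - fderiv ℂ a v ![v 1, 0, -(v 2) ^ 2] = 0)
    (h23 : ∀ v : Fin 3 → ℂ,
      fderiv ℂ c v ![0, 1, 0] - fderiv ℂ b v ![v 1, 0, -(v 2) ^ 2] = a v) :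
    ∃ (μ : (Fin 3 → ℂ) → ℂ) (A B : ℂ), Differentiable ℂ μ ∧
      (∀ v : Fin 3 → ℂ, a v = fderiv ℂ μ v ![1, 0, 0]) ∧
      (∀ v : Fin 3 → ℂ, b v = fderiv ℂ μ v ![0, 1, 0]) ∧
      (∀ v : Fin 3 → ℂ,
        c v = fderiv ℂ μ v ![v 1, 0, -(v 2) ^ 2] + A + B * v 2) := by
  let ℓ : Fin 3 → (Fin 3 → ℂ) →L[ℂ] ℂ := ContinuousLinearMap.proj
  obtain ⟨m, hm, hma, hmb⟩ := exists_potential_of_closed (e₁ := ![1, 0, 0]) (e₂ := ![0, 1, 0])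
    (ℓ₁ := ℓ 0) (ℓ₂ := ℓ 1) ha hb (by simp [ℓ]) (by simp [ℓ]) (by simp [ℓ])
    fun v => sub_eq_zero.1 (h12 v)
  have hX := fun (T : (Fin 3 → ℂ) →L[ℂ] ℂ) (v : Fin 3 → ℂ) => T.apply_cons_zero (v 1) (-(v 2) ^ 2)
  simp only [hX] at h13 h23 ⊢
  have hmz := hm.fderiv_apply_of_complex ![0, 0, 1]
  have hmza : ∀ v, fderiv ℂ (fun w => fderiv ℂ m w ![0, 0, 1]) v ![1, 0, 0] =
      fderiv ℂ a v ![0, 0, 1] := fun v => by rw [hm.fderiv_fderiv_apply_comm, funext hma]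
  have hmzb : ∀ v, fderiv ℂ (fun w => fderiv ℂ m w ![0, 0, 1]) v ![0, 1, 0] =
      fderiv ℂ b v ![0, 0, 1] := fun v => by rw [hm.fderiv_fderiv_apply_comm, funext hmb]
  -- the normalised third component, which depends on `v 2` only
  let r : (Fin 3 → ℂ) → ℂ := fun v => c v - v 1 * a v + v 2 ^ 2 * fderiv ℂ m v ![0, 0, 1]
  have hr' : ∀ v, HasFDerivAt r _ v := fun v =>
    ((hc v).hasFDerivAt.sub ((ℓ 1).hasFDerivAt.mul (ha v).hasFDerivAt)).add
      (((ℓ 2).hasFDerivAt.pow 2).mul (hmz v).hasFDerivAt)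
  have hr : Differentiable ℂ r := fun v => (hr' v).differentiableAt
  have hrx : ∀ v, fderiv ℂ r v ![1, 0, 0] = 0 := fun v => by
    rw [(hr' v).fderiv]
    simp [ℓ, hmza]
    linear_combination h13 v
  have hry : ∀ v, fderiv ℂ r v ![0, 1, 0] = 0 := fun v => by
    rw [(hr' v).fderiv]
    simp [ℓ, hmzb]
    linear_combination h23 v + v 1 * h12 v
  have hrv : ∀ v, r v = r (v 2 • ![0, 0, 1]) := fun v => by
    have hv : v 2 • ![0, 0, 1] + v 0 • ![1, 0, 0] + v 1 • ![0, 1, 0] = v := by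
      ext i
      fin_cases i <;> simp
    have h := (hr.apply_add_smul_eq hry (v 2 • ![0, 0, 1] + v 0 • ![1, 0, 0]) (v 1)).trans
      (hr.apply_add_smul_eq hrx _ _)
    rwa [hv] at h
  have hline : Differentiable ℂ fun z : ℂ => r (z • ![0, 0, 1]) :=
    hr.comp (differentiable_id.smul_const _)
  obtain ⟨A, B, g, hg, hAB⟩ := exists_eq_add_sq_mul_deriv_of_entire hline
  have hμ : ∀ v, HasFDerivAt (fun v : Fin 3 → ℂ => m v - g (v 2))
      (fderiv ℂ m v - deriv g (v 2) • ℓ 2) v := fun v =>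
    (hm v).hasFDerivAt.sub ((hg _).hasDerivAt.comp_hasFDerivAt v (ℓ 2).hasFDerivAt)
  refine ⟨fun v => m v - g (v 2), A, B, fun v => (hμ v).differentiableAt, fun v => ?_,
    fun v => ?_, fun v => ?_⟩
  · simp [(hμ v).fderiv, ℓ, hma]
  · simp [(hμ v).fderiv, ℓ, hmb]
  · have h := (hrv v).trans (hAB (v 2))
    simp [(hμ v).fderiv, ℓ, hma]
    linear_combination h
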